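/- Let T be a tree on n vertices (a connected acyclic finite simple graph) with vertex covering number τ (the minimum size of a set of vertices meeting every edge). Then w(T) = 2^{n-1} − 2^{n-1-τ}, i.e., w(T) = 2^{n-1}(1 − 2^{-τ}). -/

import Mathlib

/-- The quadratic Boolean form associated with a graph `G`:
`f_G(x) = ∑_{{i,j} ∈ E(G)} x_i x_j` over `F₂ = ZMod 2`. -/
noncomputable def quadForm {V : Type*} [Fintype V] (G : SimpleGraph V)
    (x : V → ZMod 2) : ZMod 2 := by
  classical
  exact ∑ e ∈ G.edgeFinset,
    Sym2.lift ⟨fun i j => x i * x j, fun a b => mul_comm (x a) (x b)⟩ e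

/-- The MS-number `w(G)`: the number of `x ∈ F₂^V` with `f_G(x) = 1`. -/
noncomputable def msNumber {V : Type*} [Fintype V] (G : SimpleGraph V) : ℕ := by
  classical
  exact (Finset.univ.filter fun x : V → ZMod 2 => quadForm G x = 1).card

/-- The binary rank of a graph: the rank of its adjacency matrix over `F₂`. -/
noncomputable def brank {V : Type*} [Fintype V] [DecidableEq V]
    (G : SimpleGraph V) : ℕ := by
  classical
  exact (SimpleGraph.adjMatrix (ZMod 2) G).rank

/-- A set of vertices is a vertex cover if every edge has an endpoint in it. -/
def IsVertexCover {V : Type*} (G : SimpleGraph V) (s : Finset V) : Prop :=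
  ∀ ⦃u v⦄, G.Adj u v → u ∈ s ∨ v ∈ s

/-- The monomial `x_i x_j` attached to the unordered pair `{i,j}`. -/
def edgeMonomial {V : Type*} (x : V → ZMod 2) (e : Sym2 V) : ZMod 2 :=
  Sym2.lift ⟨fun i j => x i * x j, fun a b => mul_comm (x a) (x b)⟩ e

@[simp]
lemma edgeMonomial_mk {V : Type*} (x : V → ZMod 2) (i j : V) :
    edgeMonomial x s(i, j) = x i * x j := rfl

lemma quadForm_eq_sum {V : Type*} [Fintype V] (G : SimpleGraph V) [Fintype G.edgeSet]
    (x : V → ZMod 2) : quadForm G x = ∑ e ∈ G.edgeFinset, edgeMonomial x e := by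
  unfold quadForm edgeMonomial
  congr!

/-- Changing the coordinate of a vertex `v` with unique neighbour `u` changes the form by `x u`. -/
lemma quadForm_add_single_of_unique_adj {V : Type*} [Fintype V] [DecidableEq V]
    {G : SimpleGraph V} {u v : V} (h : G.Adj v u) (hu : ∀ w, G.Adj v w → w = u)
    (x : V → ZMod 2) : quadForm G (x + Pi.single v 1) = quadForm G x + x u := by
  classical
  rw [← sub_eq_iff_eq_add', quadForm_eq_sum, quadForm_eq_sum, ← Finset.sum_sub_distrib,
    Finset.sum_eq_single_of_mem s(v, u) (by simpa using h)]
  · simp [h.ne']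
    ring
  · intro e
    induction e with | _ a b
    intro hab hne
    have hab : G.Adj a b := by simpa using hab
    have ha : a ≠ v := by
      rintro rfl
      exact hne (by rw [hu b hab])
    have hb : b ≠ v := by
      rintro rfl
      exact hne (by rw [hu a hab.symm, Sym2.eq_swap])
    simp [ha, hb]

/-- The form does not depend on the coordinate of an isolated vertex. -/
lemma quadForm_add_single_of_not_adj {V : Type*} [Fintype V] [DecidableEq V]
    {G : SimpleGraph V} {u : V} (h : ∀ w, ¬ G.Adj u w) (x : V → ZMod 2) :
    quadForm G (x + Pi.single u 1) = quadForm G x := by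
  classical
  rw [quadForm_eq_sum, quadForm_eq_sum]
  refine Finset.sum_congr rfl fun e => ?_
  induction e with | _ a b
  intro hab
  have hab : G.Adj a b := by simpa using hab
  have ha : a ≠ u := by
    rintro rfl
    exact h b hab
  have hb : b ≠ u := by
    rintro rfl
    exact h a hab.symm
  simp [ha, hb]

lemma quadForm_deleteIncidenceSet {V : Type*} [Fintype V] (G : SimpleGraph V) {u : V}
    {x : V → ZMod 2} (hx : x u = 0) : quadForm (G.deleteIncidenceSet u) x = quadForm G x := by
  classical
  rw [quadForm_eq_sum, quadForm_eq_sum]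
  refine Finset.sum_subset
    (SimpleGraph.edgeFinset_subset_edgeFinset.mpr (G.deleteIncidenceSet_le u)) fun e => ?_
  induction e with | _ a b
  simp only [SimpleGraph.mem_edgeFinset, SimpleGraph.mem_edgeSet,
    SimpleGraph.deleteIncidenceSet_adj, edgeMonomial_mk]
  intro hab hn
  by_cases ha : a = u
  · simp [ha, hx]
  · have hb : b = u := by tauto
    simp [hb, hx]

/-- The nontrivial additive character of `F₂`, with integer values. -/
def signChar (a : ZMod 2) : ℤ := if a = 0 then 1 else -1

lemma signChar_add (a b : ZMod 2) : signChar (a + b) = signChar a * signChar b := by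
  revert a b
  decide

/-- The exponential sum of the quadratic form of a graph. -/
noncomputable def signSum {V : Type*} [Fintype V] (G : SimpleGraph V) : ℤ := by
  classical
  exact ∑ x : V → ZMod 2, signChar (quadForm G x)

lemma signSum_eq_sum {V : Type*} [Fintype V] [DecidableEq V] (G : SimpleGraph V) :
    signSum G = ∑ x : V → ZMod 2, signChar (quadForm G x) := by
  unfold signSum
  congr!

lemma signSum_add_two_mul_msNumber {V : Type*} [Fintype V] (G : SimpleGraph V) :
    signSum G + 2 * msNumber G = 2 ^ Fintype.card V := by
  classical
  have h (a : ZMod 2) : signChar a + 2 * (if a = 1 then 1 else 0) = 1 := by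
    revert a
    decide
  have hw : (msNumber G : ℤ) = ∑ x : V → ZMod 2, if quadForm G x = 1 then 1 else 0 := by
    rw [Finset.sum_boole]
    unfold msNumber
    congr!
  rw [signSum_eq_sum, hw, Finset.mul_sum, ← Finset.sum_add_distrib]
  simp only [h]
  simp

/-- Deleting the edges at the neighbour of a leaf doubles the exponential sum. -/
lemma two_mul_signSum {V : Type*} [Fintype V] {G : SimpleGraph V} {u v : V} (h : G.Adj v u)
    (hu : ∀ w, G.Adj v w → w = u) : 2 * signSum G = signSum (G.deleteIncidenceSet u) := by
  classical
  set H := G.deleteIncidenceSet u with hH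
  have hshift (w : V) (F : (V → ZMod 2) → ℤ) : ∑ x, F (x + Pi.single w 1) = ∑ x, F x :=
    Equiv.sum_comp (Equiv.addRight (Pi.single w 1)) F
  have hzero : ∑ x : V → ZMod 2, signChar (quadForm H x) * signChar (x u) = 0 := by
    have hs := hshift u fun x => signChar (quadForm H x) * signChar (x u)
    have hone : signChar 1 = -1 := rfl
    have hiso : ∀ w, ¬ H.Adj u w := by simp [hH, SimpleGraph.deleteIncidenceSet_adj]
    simp only [quadForm_add_single_of_not_adj hiso, Pi.add_apply, Pi.single_eq_same,
      signChar_add, hone, mul_neg, mul_one, Finset.sum_neg_distrib] at hs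
    omega
  have hsum : 2 * signSum G =
      ∑ x : V → ZMod 2, signChar (quadForm G x) * (1 + signChar (x u)) := by
    simp only [mul_add, mul_one, Finset.sum_add_distrib, ← signChar_add,
      ← quadForm_add_single_of_unique_adj h hu]
    rw [hshift v fun x => signChar (quadForm G x), signSum_eq_sum, two_mul]
  have hdel (x : V → ZMod 2) : signChar (quadForm G x) * (1 + signChar (x u)) =
      signChar (quadForm H x) * (1 + signChar (x u)) := by
    by_cases hx : x u = 0
    · rw [hH, quadForm_deleteIncidenceSet G hx]
    · simp [signChar, hx]
  rw [hsum, signSum_eq_sum]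
  simp only [hdel, mul_add, mul_one, Finset.sum_add_distrib, hzero, add_zero]

/-- A finite acyclic graph with an edge has a leaf. -/
lemma exists_unique_adj_of_isAcyclic {V : Type*} [Finite V] {G : SimpleGraph V}
    (hG : G.IsAcyclic) (hne : G ≠ ⊥) : ∃ u v, G.Adj v u ∧ ∀ w, G.Adj v w → w = u := by
  classical
  obtain ⟨a, b, hab⟩ := SimpleGraph.ne_bot_iff_exists_adj.mp hne
  have : Nonempty V := ⟨a⟩
  obtain ⟨v, z, p, hp, hmax⟩ := SimpleGraph.Walk.exists_isPath_forall_isPath_length_le_length G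
  have hnil : ¬ p.Nil := by
    intro hn
    have hlen := hmax a b hab.toWalk (by simp [SimpleGraph.Walk.cons_isPath_iff, hab.ne])
    rw [SimpleGraph.Walk.length_eq_zero_iff.mpr hn] at hlen
    simp at hlen
  refine ⟨_, v, p.adj_snd hnil, fun w hadj => ?_⟩
  apply hG.eq_snd_of_adj_start hp hadj
  have : ¬ (p.cons hadj.symm).IsPath := by grind [SimpleGraph.Walk.length_cons]
  grind [hp.cons]

/-- The exponential sum of a forest with vertex covering number `k` is `2 ^ (|V| - k)`. -/
theorem exists_isLeast_signSum_of_isAcyclic {V : Type*} [Fintype V]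
    (G : SimpleGraph V) (hG : G.IsAcyclic) :
    ∃ k, IsLeast {k | ∃ s : Finset V, IsVertexCover G s ∧ s.card = k} k ∧
      2 ^ k * signSum G = 2 ^ Fintype.card V := by
  classical
  induction G using WellFoundedLT.induction with
  | ind G ih =>
  by_cases hne : G = ⊥
  · subst hne
    refine ⟨0, ⟨⟨∅, by simp [IsVertexCover], rfl⟩, fun _ _ => Nat.zero_le _⟩, ?_⟩
    simp [signSum_eq_sum, quadForm_eq_sum, signChar]
  obtain ⟨u, v, h, hu⟩ := exists_unique_adj_of_isAcyclic hG hne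
  have hadj {a b : V} := SimpleGraph.deleteIncidenceSet_adj (G := G) (x := u) (v₁ := a) (v₂ := b)
  have hlt : G.deleteIncidenceSet u < G :=
    lt_of_le_of_ne (G.deleteIncidenceSet_le u) fun he => (hadj.mp (he ▸ h)).2.2 rfl
  obtain ⟨k, ⟨⟨s, hs, hsk⟩, hk⟩, hsum⟩ := ih _ hlt (hG.anti hlt.le)
  have hlower (t : Finset V) (ht : IsVertexCover G t) : k + 1 ≤ t.card := by
    obtain ⟨w, hw, hcov⟩ : ∃ w ∈ t, IsVertexCover (G.deleteIncidenceSet u) (t.erase w) := by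
      by_cases hut : u ∈ t
      · refine ⟨u, hut, fun a b hab => ?_⟩
        have := hadj.mp hab
        have := ht this.1
        grind
      · refine ⟨v, (ht h).resolve_right hut, fun a b hab => ?_⟩
        obtain ⟨hab, ha, hb⟩ := hadj.mp hab
        have := ht hab
        have := hu a
        have := hu b
        have := hab.symm
        grind
    have := hk ⟨_, hcov, rfl⟩
    rw [← Finset.card_erase_add_one hw]
    omega
  have hins : IsVertexCover G (insert u s) := by
    intro a b hab
    by_cases ha : a = u
    · simp [ha]
    by_cases hb : b = u
    · simp [hb]
    have := hs (hadj.mpr ⟨hab, ha, hb⟩)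
    grind
  refine ⟨k + 1, ⟨⟨insert u s, hins, ?_⟩, ?_⟩, ?_⟩
  · have := hlower _ hins
    have := Finset.card_insert_le u s
    omega
  · rintro _ ⟨t, ht, rfl⟩
    exact hlower t ht
  · rw [pow_succ, mul_assoc, two_mul_signSum h hu, hsum]

theorem msNumber_tree {n : ℕ} (T : SimpleGraph (Fin n)) (hT : T.IsTree)
    (τ : ℕ)
    (hτ : IsLeast {k | ∃ s : Finset (Fin n), IsVertexCover T s ∧ s.card = k} τ) :
    msNumber T = 2 ^ (n - 1) - 2 ^ (n - 1 - τ) := by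
  obtain ⟨k, hk, hsum⟩ := exists_isLeast_signSum_of_isAcyclic T hT.isAcyclic
  obtain rfl := hτ.unique hk
  obtain ⟨r⟩ := hT.connected.nonempty
  have hcard : τ ≤ n - 1 := by
    refine hτ.2 ⟨Finset.univ.erase r, fun a b hab => ?_, by simp⟩
    have := hab.ne
    grind
  obtain ⟨m, hm⟩ := Nat.exists_eq_add_of_le hcard
  have hn : n = τ + m + 1 := by
    have := r.pos
    omega
  have hadd := signSum_add_two_mul_msNumber T
  rw [Fintype.card_fin] at hsum hadd
  have hS : signSum T = 2 ^ (m + 1) := by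
    apply mul_left_cancel₀ (pow_ne_zero τ (two_ne_zero (α := ℤ)))
    rw [hsum, ← pow_add]
    congr 1
  have hpow : (2 : ℤ) ^ n = 2 * 2 ^ (τ + m) := by
    rw [← pow_succ']
    congr 1
  rw [hS, hpow, pow_succ] at hadd
  have hw : 2 ^ m + msNumber T = 2 ^ (τ + m) := by
    zify
    linarith
  rw [hm, Nat.add_sub_cancel_left]
  omega
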